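/- Let Γ be a metric-compatible (x₀,t₀)-soliton on the trivial bundle ℝⁿ × ℝᵐ with polynomial curvature growth to order two, set G₀(x) := e^{−|x−x₀|²/(4t₀)}, and let V ∈ ℝⁿ be a constant vector. Then: (c) ∫_{ℝⁿ} |x−x₀|⁴ |F|² G₀ dx = 4(n−2)(n−4) t₀² ∫_{ℝⁿ} |F|² G₀ dx − 64 t₀³ ∫_{ℝⁿ} |D*F|² G₀ dx; and (e) ∫_{ℝⁿ} ⟨V, x−x₀⟩² |F|² G₀ dx = 2t₀ |V|² ∫_{ℝⁿ} |F|² G₀ dx − 8t₀ ∫_{ℝⁿ} |V ⌟ F|² G₀ dx. -/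

import Mathlib

open MeasureTheory Real Filter Matrix
open scoped ENNReal

noncomputable section

namespace YM

variable {n m : ℕ}

/-- A connection on the trivial bundle `ℝⁿ × ℝᵐ`, given by its coefficient
matrices `Γ₁(x), …, Γₙ(x)`. -/
abbrev Conn (n m : ℕ) :=
  (Fin n → ℝ) → Fin n → Matrix (Fin m) (Fin m) ℝ

/-- Entrywise `i`-th partial derivative of a matrix-valued map on `ℝⁿ`. -/
def pder (i : Fin n) (A : (Fin n → ℝ) → Matrix (Fin m) (Fin m) ℝ)
    (x : Fin n → ℝ) : Matrix (Fin m) (Fin m) ℝ :=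
  Matrix.of fun a b => fderiv ℝ (fun y => A y a b) x (Pi.single i 1)

/-- Smoothness (entrywise) of a matrix-valued map on `ℝⁿ`. -/
def SmoothMat (A : (Fin n → ℝ) → Matrix (Fin m) (Fin m) ℝ) : Prop :=
  ∀ a b, ContDiff ℝ (⊤ : ℕ∞) fun y => A y a b

/-- Smoothness of a connection. -/
def Smooth (Γ : Conn n m) : Prop :=
  ∀ i, SmoothMat fun x => Γ x i

/-- Matrix commutator. -/
def comm (A B : Matrix (Fin m) (Fin m) ℝ) : Matrix (Fin m) (Fin m) ℝ :=
  A * B - B * A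

/-- Curvature `F_{ij} = ∂ᵢΓⱼ − ∂ⱼΓᵢ + [Γᵢ, Γⱼ]`. -/
def curv (Γ : Conn n m) (i j : Fin n) (x : Fin n → ℝ) :
    Matrix (Fin m) (Fin m) ℝ :=
  pder i (fun y => Γ y j) x - pder j (fun y => Γ y i) x + comm (Γ x i) (Γ x j)

/-- Covariant derivative `∇ᵢA = ∂ᵢA + [Γᵢ, A]`. -/
def covDer (Γ : Conn n m) (i : Fin n)
    (A : (Fin n → ℝ) → Matrix (Fin m) (Fin m) ℝ) (x : Fin n → ℝ) :
    Matrix (Fin m) (Fin m) ℝ :=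
  pder i A x + comm (Γ x i) (A x)

/-- `(D*F)ₖ = −Σᵢ ∇ᵢF_{ik}`. -/
def dstarF (Γ : Conn n m) (k : Fin n) (x : Fin n → ℝ) :
    Matrix (Fin m) (Fin m) ℝ :=
  - ∑ i, covDer Γ i (fun y => curv Γ i k y) x

/-- Squared Frobenius norm of a matrix. -/
def frobSq (A : Matrix (Fin m) (Fin m) ℝ) : ℝ := ∑ a, ∑ b, (A a b) ^ 2

/-- Frobenius norm of a matrix. -/
def frobNorm (A : Matrix (Fin m) (Fin m) ℝ) : ℝ := Real.sqrt (frobSq A)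

/-- Frobenius inner product `⟨A, B⟩ = tr(A Bᵀ)`. -/
def frobInner (A B : Matrix (Fin m) (Fin m) ℝ) : ℝ := ∑ a, ∑ b, A a b * B a b

/-- `|F(x)|² = Σ_{i,j} ‖F_{ij}(x)‖²` (Frobenius norms). -/
def normSqF (Γ : Conn n m) (x : Fin n → ℝ) : ℝ :=
  ∑ i, ∑ j, frobSq (curv Γ i j x)

/-- `|F(x)|`. -/
def normF (Γ : Conn n m) (x : Fin n → ℝ) : ℝ := Real.sqrt (normSqF Γ x)

/-- Euclidean norm on `ℝⁿ`. -/
def enorm (x : Fin n → ℝ) : ℝ := Real.sqrt (∑ i, x i ^ 2)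

/-- Metric compatibility: all coefficient matrices are skew-symmetric. -/
def MetricCompat (Γ : Conn n m) : Prop :=
  ∀ x i, (Γ x i)ᵀ = -(Γ x i)

/-- `(x₀,t₀)`-soliton: `Σᵢ ∇ᵢF_{ik} = (1/(2t₀)) Σᵢ (x−x₀)ᵢ F_{ik}`. -/
def IsSolitonAt (Γ : Conn n m) (x₀ : Fin n → ℝ) (t₀ : ℝ) : Prop :=
  ∀ (x : Fin n → ℝ) (k : Fin n),
    ∑ i, covDer Γ i (fun y => curv Γ i k y) x
      = (1 / (2 * t₀)) • ∑ i, (x i - x₀ i) • curv Γ i k x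

/-- `(0,1)`-soliton. -/
def IsSoliton (Γ : Conn n m) : Prop := IsSolitonAt Γ 0 1

/-- The `ℱ`-functional
`ℱ_{x₀,t₀}(Γ) = t₀² (4πt₀)^{−n/2} ∫ |F|² e^{−|x−x₀|²/(4t₀)}`. -/
def Ffunc (Γ : Conn n m) (x₀ : Fin n → ℝ) (t₀ : ℝ) : ℝ :=
  t₀ ^ 2 * (4 * π * t₀) ^ (-(n : ℝ) / 2) *
    ∫ x : Fin n → ℝ,
      normSqF Γ x * Real.exp (-(∑ i, (x i - x₀ i) ^ 2) / (4 * t₀))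

/-- The entropy `λ(Γ) = sup_{x₀, t₀>0} ℱ_{x₀,t₀}(Γ)`, valued in `[0,∞]`. -/
def entropy (Γ : Conn n m) : ℝ≥0∞ :=
  ⨆ (x₀ : Fin n → ℝ) (t₀ : ℝ) (_ : 0 < t₀), ENNReal.ofReal (Ffunc Γ x₀ t₀)

/-- Polynomial curvature growth: `|F(x)| ≤ p(|x|)`. -/
def PolyCurvGrowth (Γ : Conn n m) : Prop :=
  ∃ p : Polynomial ℝ, ∀ x, normF Γ x ≤ p.eval (enorm x)

/-- Polynomial curvature growth to order two. -/
def PolyCurvGrowth2 (Γ : Conn n m) : Prop :=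
  ∃ p : Polynomial ℝ, ∀ x,
    normF Γ x
      + (∑ i, ∑ j, ∑ k, frobNorm (covDer Γ i (fun y => curv Γ j k y) x))
      + (∑ i, ∑ j, ∑ k, ∑ l,
          frobNorm (covDer Γ i
            (fun y => covDer Γ j (fun z => curv Γ k l z) y) x))
      ≤ p.eval (enorm x)

/-- Cylindrical: some nonzero constant vector `V` satisfies `V ⌟ F ≡ 0`. -/
def Cylindrical (Γ : Conn n m) : Prop :=
  ∃ V : Fin n → ℝ, V ≠ 0 ∧
    ∀ (x : Fin n → ℝ) (k : Fin n), ∑ i, V i • curv Γ i k x = 0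

/-- `(DB)_{ij} = ∇ᵢBⱼ − ∇ⱼBᵢ`. -/
def Dop (Γ B : Conn n m) (i j : Fin n) (x : Fin n → ℝ) :
    Matrix (Fin m) (Fin m) ℝ :=
  covDer Γ i (fun y => B y j) x - covDer Γ j (fun y => B y i) x

/-- The second variation operator
`(L_{x₀,t₀}B)ₖ = −Σᵢ∇ᵢ(DB)_{ik} + (1/(2t₀))Σᵢ(x−x₀)ᵢ(DB)_{ik} + Σᵢ[Bᵢ,F_{ik}]`. -/
def Lop (Γ B : Conn n m) (x₀ : Fin n → ℝ) (t₀ : ℝ) (k : Fin n)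
    (x : Fin n → ℝ) : Matrix (Fin m) (Fin m) ℝ :=
  (- ∑ i, covDer Γ i (fun y => Dop Γ B i k y) x)
    + (1 / (2 * t₀)) • ∑ i, (x i - x₀ i) • Dop Γ B i k x
    + ∑ i, comm (B x i) (curv Γ i k x)

/-- The Gaussian weight `G(x) = (4π)^{−n/2} e^{−|x|²/4}`. -/
def gaussG (n : ℕ) (x : Fin n → ℝ) : ℝ :=
  (4 * π) ^ (-(n : ℝ) / 2) * Real.exp (-(∑ i, x i ^ 2) / 4)

/-- The second variation form `Q(σ,V,B)` of a `(0,1)`-soliton. -/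
def Q (Γ : Conn n m) (σ : ℝ) (V : Fin n → ℝ) (B : Conn n m) : ℝ :=
  -4 * σ ^ 2 * (∫ x : Fin n → ℝ, (∑ k, frobSq (dstarF Γ k x)) * gaussG n x)
    - 2 * (∫ x : Fin n → ℝ,
        (∑ k, frobSq (∑ i, V i • curv Γ i k x)) * gaussG n x)
    + 4 * (∫ x : Fin n → ℝ,
        (∑ k, frobInner (B x k) (Lop Γ B 0 1 k x)) * gaussG n x)
    - 4 * (∫ x : Fin n → ℝ,
        (∑ k, frobInner (B x k)
          (∑ i, (σ * x i + V i) • curv Γ i k x)) * gaussG n x)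

/-- Skew-symmetric-matrix-valued 1-form. -/
def SkewVals (B : Conn n m) : Prop := ∀ x i, (B x i)ᵀ = -(B x i)

/-- `ℱ`-instability. -/
def FUnstable (Γ : Conn n m) : Prop :=
  ∃ B : Conn n m, Smooth B ∧ HasCompactSupport B ∧ SkewVals B ∧
    ∀ (σ : ℝ) (V : Fin n → ℝ), Q Γ σ V B < 0

/-- Joint smoothness (entrywise) of a one-parameter family of connections on a
time set `S`. -/
def SmoothFamilyOn (Γt : ℝ → Conn n m) (S : Set ℝ) : Prop :=
  ∀ (k : Fin n) (a b : Fin m),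
    ContDiffOn ℝ (⊤ : ℕ∞) (fun p : ℝ × (Fin n → ℝ) => Γt p.1 p.2 k a b)
      (S ×ˢ (Set.univ : Set (Fin n → ℝ)))

/-- Yang–Mills flow: `∂ₜ(Γ_t)ₖ = Σᵢ ∇ᵢ(F_t)_{ik}` on a time set `S`. -/
def YMFlowOn (Γt : ℝ → Conn n m) (S : Set ℝ) : Prop :=
  ∀ t ∈ S, ∀ (x : Fin n → ℝ) (k : Fin n) (a b : Fin m),
    HasDerivWithinAt (fun t' => Γt t' x k a b)
      ((∑ i, covDer (Γt t) i (fun y => curv (Γt t) i k y) x) a b) S t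

/-- Locally uniform in time polynomial curvature growth to order two. -/
def PolyCurvGrowth2On (Γt : ℝ → Conn n m) (S : Set ℝ) : Prop :=
  ∀ J : Set ℝ, IsCompact J → J ⊆ S →
    ∃ p : Polynomial ℝ, ∀ t ∈ J, ∀ x,
      normF (Γt t) x
        + (∑ i, ∑ j, ∑ k,
            frobNorm (covDer (Γt t) i (fun y => curv (Γt t) j k y) x))
        + (∑ i, ∑ j, ∑ k, ∑ l,
            frobNorm (covDer (Γt t) i
              (fun y => covDer (Γt t) j (fun z => curv (Γt t) k l z) y) x))
        ≤ p.eval (enorm x)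

end YM


namespace YM

variable {n m : ℕ}

lemma SmoothMat.contDiff {A : (Fin n → ℝ) → Matrix (Fin m) (Fin m) ℝ} (hA : SmoothMat A)
    (a b : Fin m) : ContDiff ℝ (⊤ : ℕ∞) fun y => A y a b := hA a b

lemma SmoothMat.diff {A : (Fin n → ℝ) → Matrix (Fin m) (Fin m) ℝ} (hA : SmoothMat A)
    (a b : Fin m) (x : Fin n → ℝ) : DifferentiableAt ℝ (fun y => A y a b) x :=
  ((hA a b).differentiable (by simp)).differentiableAt

lemma contDiff_partial {f : (Fin n → ℝ) → ℝ} (hf : ContDiff ℝ (⊤ : ℕ∞) f) (v : Fin n → ℝ) :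
    ContDiff ℝ (⊤ : ℕ∞) fun y => fderiv ℝ f y v := by
  have h : ContDiff ℝ (⊤ : ℕ∞) (fderiv ℝ f) :=
    hf.fderiv_right (by simp)
  exact h.clm_apply contDiff_const

lemma SmoothMat.pder {A : (Fin n → ℝ) → Matrix (Fin m) (Fin m) ℝ} (hA : SmoothMat A)
    (i : Fin n) : SmoothMat (fun y => pder i A y) := by
  intro a b
  simpa [YM.pder] using contDiff_partial (hA a b) (Pi.single i 1)

lemma SmoothMat.add {A B : (Fin n → ℝ) → Matrix (Fin m) (Fin m) ℝ} (hA : SmoothMat A)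
    (hB : SmoothMat B) : SmoothMat (fun y => A y + B y) := by
  intro a b
  simpa using (hA a b).add (hB a b)

lemma SmoothMat.sub {A B : (Fin n → ℝ) → Matrix (Fin m) (Fin m) ℝ} (hA : SmoothMat A)
    (hB : SmoothMat B) : SmoothMat (fun y => A y - B y) := by
  intro a b
  simpa using (hA a b).sub (hB a b)

lemma SmoothMat.mul {A B : (Fin n → ℝ) → Matrix (Fin m) (Fin m) ℝ} (hA : SmoothMat A)
    (hB : SmoothMat B) : SmoothMat (fun y => A y * B y) := by
  intro a b
  simp only [Matrix.mul_apply]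
  exact ContDiff.sum fun c _ => (hA a c).mul (hB c b)

lemma SmoothMat.comm {A B : (Fin n → ℝ) → Matrix (Fin m) (Fin m) ℝ} (hA : SmoothMat A)
    (hB : SmoothMat B) : SmoothMat (fun y => comm (A y) (B y)) :=
  (hA.mul hB).sub (hB.mul hA)

lemma Smooth.curv {Γ : Conn n m} (hΓ : Smooth Γ) (i j : Fin n) :
    SmoothMat (fun y => curv Γ i j y) :=
  (((hΓ j).pder i).sub ((hΓ i).pder j)).add ((hΓ i).comm (hΓ j))

lemma Smooth.covDer {Γ : Conn n m} (hΓ : Smooth Γ) (i : Fin n)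
    {A : (Fin n → ℝ) → Matrix (Fin m) (Fin m) ℝ} (hA : SmoothMat A) :
    SmoothMat (fun y => covDer Γ i A y) :=
  (hA.pder i).add ((hΓ i).comm hA)

lemma pder_add (i : Fin n) {A B : (Fin n → ℝ) → Matrix (Fin m) (Fin m) ℝ} (hA : SmoothMat A)
    (hB : SmoothMat B) (x : Fin n → ℝ) :
    pder i (fun y => A y + B y) x = pder i A x + pder i B x := by
  ext a b
  simp only [pder, Matrix.of_apply, Matrix.add_apply]
  rw [fderiv_fun_add (hA.diff a b x) (hB.diff a b x)]
  rfl

lemma pder_sub (i : Fin n) {A B : (Fin n → ℝ) → Matrix (Fin m) (Fin m) ℝ} (hA : SmoothMat A)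
    (hB : SmoothMat B) (x : Fin n → ℝ) :
    pder i (fun y => A y - B y) x = pder i A x - pder i B x := by
  ext a b
  simp only [pder, Matrix.of_apply, Matrix.sub_apply]
  rw [fderiv_fun_sub (hA.diff a b x) (hB.diff a b x)]
  rfl

lemma pder_mul (i : Fin n) {A B : (Fin n → ℝ) → Matrix (Fin m) (Fin m) ℝ} (hA : SmoothMat A)
    (hB : SmoothMat B) (x : Fin n → ℝ) :
    pder i (fun y => A y * B y) x = pder i A x * B x + A x * pder i B x := by
  ext a b
  simp only [pder, Matrix.of_apply, Matrix.add_apply, Matrix.mul_apply]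
  rw [fderiv_fun_sum (fun c _ => (hA.diff a c x).fun_mul (hB.diff c b x)),
    _root_.sum_apply, ← Finset.sum_add_distrib]
  refine Finset.sum_congr rfl fun c _ => ?_
  rw [fderiv_fun_mul (hA.diff a c x) (hB.diff c b x)]
  simp
  ring

lemma pder_comm_bracket (i : Fin n) {A B : (Fin n → ℝ) → Matrix (Fin m) (Fin m) ℝ}
    (hA : SmoothMat A) (hB : SmoothMat B) (x : Fin n → ℝ) :
    pder i (fun y => comm (A y) (B y)) x = comm (pder i A x) (B x) + comm (A x) (pder i B x) := by
  simp only [comm]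
  rw [pder_sub i (hA.mul hB) (hB.mul hA), pder_mul i hA hB, pder_mul i hB hA]
  abel

lemma pder_symm (i j : Fin n) {A : (Fin n → ℝ) → Matrix (Fin m) (Fin m) ℝ} (hA : SmoothMat A)
    (x : Fin n → ℝ) :
    pder i (fun y => pder j A y) x = pder j (fun y => pder i A y) x := by
  ext a b
  simp only [pder, Matrix.of_apply]
  have hs : IsSymmSndFDerivAt ℝ (fun y => A y a b) x :=
    (hA a b).contDiffAt.isSymmSndFDerivAt
      (by rw [minSmoothness_of_isRCLikeNormedField]; exact WithTop.coe_le_coe.2 (le_top : (2 : ℕ∞) ≤ ⊤))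
  have hd : DifferentiableAt ℝ (fderiv ℝ (fun y => A y a b)) x :=
    (((hA a b).fderiv_right (m := (⊤ : ℕ∞)) (by simp)).differentiable (by simp)).differentiableAt
  have key : ∀ v w : Fin n → ℝ, fderiv ℝ (fun y => fderiv ℝ (fun y => A y a b) y v) x w
      = fderiv ℝ (fderiv ℝ (fun y => A y a b)) x w v := by
    intro v w
    rw [fderiv_clm_apply hd (differentiableAt_const v)]
    simp
  rw [key, key]
  exact hs _ _

lemma pder_curv {Γ : Conn n m} (hΓ : Smooth Γ) (i j k : Fin n) (x : Fin n → ℝ) :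
    pder i (fun y => curv Γ j k y) x =
      pder i (fun y => pder j (fun z => Γ z k) y) x - pder i (fun y => pder k (fun z => Γ z j) y) x
      + (comm (pder i (fun y => Γ y j) x) (Γ x k) + comm (Γ x j) (pder i (fun y => Γ y k) x)) := by
  rw [← pder_comm_bracket i (hΓ j) (hΓ k), ← pder_sub i ((hΓ k).pder j) ((hΓ j).pder k),
    ← pder_add i (((hΓ k).pder j).sub ((hΓ j).pder k)) ((hΓ j).comm (hΓ k))]
  rfl

/-- The second Bianchi identity. -/
lemma bianchi {Γ : Conn n m} (hΓ : Smooth Γ) (i j k : Fin n) (x : Fin n → ℝ) :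
    covDer Γ i (fun y => curv Γ j k y) x + covDer Γ j (fun y => curv Γ k i y) x
      + covDer Γ k (fun y => curv Γ i j y) x = 0 := by
  simp only [covDer]
  rw [pder_curv hΓ, pder_curv hΓ, pder_curv hΓ, pder_symm j i (hΓ k), pder_symm k i (hΓ j),
    pder_symm k j (hΓ i)]
  simp only [curv, comm]
  noncomm_ring

lemma curv_antisymm (Γ : Conn n m) (i j : Fin n) (x : Fin n → ℝ) :
    curv Γ i j x = - curv Γ j i x := by
  simp only [curv, comm]
  abel

lemma covDer_curv_antisymm {Γ : Conn n m} (k i j : Fin n) (x : Fin n → ℝ) :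
    covDer Γ k (fun y => curv Γ i j y) x = - covDer Γ k (fun y => curv Γ j i y) x := by
  have h : (fun y => curv Γ i j y) = fun y => - curv Γ j i y := by
    funext y; exact curv_antisymm Γ i j y
  rw [h]
  ext a b
  simp [covDer, pder, comm]
  ring

lemma frobInner_eq_trace (A B : Matrix (Fin m) (Fin m) ℝ) :
    frobInner A B = (A * Bᵀ).trace := by
  simp [frobInner, Matrix.trace, Matrix.mul_apply]

lemma frobInner_add_left (A B C : Matrix (Fin m) (Fin m) ℝ) :
    frobInner (A + B) C = frobInner A C + frobInner B C := by
  simp [frobInner_eq_trace, Matrix.add_mul]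

lemma frobInner_add_right (A B C : Matrix (Fin m) (Fin m) ℝ) :
    frobInner A (B + C) = frobInner A B + frobInner A C := by
  simp [frobInner_eq_trace, Matrix.mul_add]

lemma frobInner_neg_left (A B : Matrix (Fin m) (Fin m) ℝ) :
    frobInner (-A) B = - frobInner A B := by
  simp [frobInner_eq_trace]

lemma frobInner_neg_right (A B : Matrix (Fin m) (Fin m) ℝ) :
    frobInner A (-B) = - frobInner A B := by
  simp [frobInner_eq_trace]

lemma frobInner_smul_left (c : ℝ) (A B : Matrix (Fin m) (Fin m) ℝ) :
    frobInner (c • A) B = c * frobInner A B := by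
  simp [frobInner_eq_trace]

lemma frobInner_smul_right (c : ℝ) (A B : Matrix (Fin m) (Fin m) ℝ) :
    frobInner A (c • B) = c * frobInner A B := by
  simp [frobInner_eq_trace]

lemma frobInner_sum_left {ι : Type*} (s : Finset ι) (A : ι → Matrix (Fin m) (Fin m) ℝ)
    (B : Matrix (Fin m) (Fin m) ℝ) :
    frobInner (∑ i ∈ s, A i) B = ∑ i ∈ s, frobInner (A i) B := by
  simp [frobInner_eq_trace, Matrix.sum_mul, Matrix.trace_sum]

lemma frobInner_symm (A B : Matrix (Fin m) (Fin m) ℝ) : frobInner A B = frobInner B A := by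
  simp [frobInner, mul_comm]

lemma frobInner_sum_right {ι : Type*} (s : Finset ι) (A : ι → Matrix (Fin m) (Fin m) ℝ)
    (B : Matrix (Fin m) (Fin m) ℝ) :
    frobInner B (∑ i ∈ s, A i) = ∑ i ∈ s, frobInner B (A i) := by
  rw [frobInner_symm, frobInner_sum_left]
  exact Finset.sum_congr rfl fun i _ => frobInner_symm _ _

lemma frobSq_eq (A : Matrix (Fin m) (Fin m) ℝ) : frobSq A = frobInner A A := by
  simp [frobInner, frobSq, sq]

lemma frobInner_comm_skew (K A B : Matrix (Fin m) (Fin m) ℝ) (hK : Kᵀ = -K) :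
    frobInner (comm K A) B + frobInner A (comm K B) = 0 := by
  simp only [frobInner_eq_trace, comm, Matrix.transpose_sub, Matrix.transpose_mul, hK,
    Matrix.sub_mul, Matrix.mul_sub, Matrix.trace_sub, Matrix.mul_neg, Matrix.neg_mul,
    Matrix.trace_neg]
  have h1 : (K * A * Bᵀ).trace = (A * (Bᵀ * K)).trace := by
    rw [Matrix.mul_assoc, Matrix.trace_mul_comm, Matrix.mul_assoc]
  have h2 : (A * K * Bᵀ).trace = (A * (K * Bᵀ)).trace := by
    rw [Matrix.mul_assoc]
  rw [h1, h2]
  ring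

lemma fderiv_frobInner {Γ : Conn n m} (hmc : MetricCompat Γ) (i : Fin n)
    {A B : (Fin n → ℝ) → Matrix (Fin m) (Fin m) ℝ}
    (hA : SmoothMat A) (hB : SmoothMat B) (x : Fin n → ℝ) :
    fderiv ℝ (fun y => frobInner (A y) (B y)) x (Pi.single i 1) =
      frobInner (covDer Γ i A x) (B x) + frobInner (A x) (covDer Γ i B x) := by
  have h0 := frobInner_comm_skew (Γ x i) (A x) (B x) (hmc x i)
  have h1 : fderiv ℝ (fun y => frobInner (A y) (B y)) x (Pi.single i 1) =
      frobInner (pder i A x) (B x) + frobInner (A x) (pder i B x) := by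
    simp only [frobInner]
    rw [fderiv_fun_sum (fun a _ => DifferentiableAt.fun_sum
      (fun b _ => (hA.diff a b x).fun_mul (hB.diff a b x))), _root_.sum_apply,
      ← Finset.sum_add_distrib]
    refine Finset.sum_congr rfl fun a _ => ?_
    rw [fderiv_fun_sum (fun b _ => (hA.diff a b x).fun_mul (hB.diff a b x)),
      _root_.sum_apply, ← Finset.sum_add_distrib]
    refine Finset.sum_congr rfl fun b _ => ?_
    rw [fderiv_fun_mul (hA.diff a b x) (hB.diff a b x)]
    simp [pder]
    ring
  simp only [covDer, frobInner_add_left, frobInner_add_right]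
  rw [h1]
  linarith

lemma SmoothMat.frobInner {A B : (Fin n → ℝ) → Matrix (Fin m) (Fin m) ℝ}
    (hA : SmoothMat A) (hB : SmoothMat B) :
    ContDiff ℝ (⊤ : ℕ∞) fun y => frobInner (A y) (B y) := by
  simp only [YM.frobInner]
  exact ContDiff.sum fun a _ => ContDiff.sum fun b _ => (hA a b).mul (hB a b)

end YM

namespace YM

variable {n m : ℕ}

/-- Continuous functions of at most exponential growth. -/
def PG (f : (Fin n → ℝ) → ℝ) : Prop :=
  Continuous f ∧ ∃ C c : ℝ, 0 ≤ C ∧ 0 ≤ c ∧ ∀ x, |f x| ≤ C * Real.exp (c * ∑ i, |x i|)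

lemma sum_abs_nonneg (x : Fin n → ℝ) : 0 ≤ ∑ i, |x i| :=
  Finset.sum_nonneg fun i _ => abs_nonneg _

lemma PG.const (r : ℝ) : PG (fun _ : Fin n → ℝ => r) :=
  ⟨continuous_const, |r|, 0, abs_nonneg _, le_rfl, fun x => by simp⟩

lemma PG.coord (i : Fin n) : PG (fun x : Fin n → ℝ => x i) := by
  refine ⟨continuous_apply i, 1, 1, zero_le_one, zero_le_one, fun x => ?_⟩
  have h : |x i| ≤ ∑ j, |x j| :=
    Finset.single_le_sum (f := fun j => |x j|) (fun j _ => abs_nonneg _) (Finset.mem_univ i)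
  have h2 := Real.add_one_le_exp (∑ j, |x j|)
  simp only [one_mul]
  linarith

lemma PG.add {f g : (Fin n → ℝ) → ℝ} (hf : PG f) (hg : PG g) : PG (fun x => f x + g x) := by
  obtain ⟨hf0, C, c, hC, hc, hf⟩ := hf
  obtain ⟨hg0, D, d, hD, hd, hg⟩ := hg
  refine ⟨hf0.add hg0, C + D, c + d, by positivity, by positivity, fun x => ?_⟩
  have hs := sum_abs_nonneg x
  have h1 : Real.exp (c * ∑ i, |x i|) ≤ Real.exp ((c + d) * ∑ i, |x i|) := by
    apply Real.exp_le_exp.2; nlinarith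
  have h2 : Real.exp (d * ∑ i, |x i|) ≤ Real.exp ((c + d) * ∑ i, |x i|) := by
    apply Real.exp_le_exp.2; nlinarith
  have h3 := mul_le_mul_of_nonneg_left h1 hC
  have h4 := mul_le_mul_of_nonneg_left h2 hD
  have := abs_add_le (f x) (g x)
  have := hf x
  have := hg x
  linarith

lemma PG.mul {f g : (Fin n → ℝ) → ℝ} (hf : PG f) (hg : PG g) : PG (fun x => f x * g x) := by
  obtain ⟨hf0, C, c, hC, hc, hf⟩ := hf
  obtain ⟨hg0, D, d, hD, hd, hg⟩ := hg
  refine ⟨hf0.mul hg0, C * D, c + d, by positivity, by positivity, fun x => ?_⟩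
  rw [abs_mul, add_mul, Real.exp_add]
  calc |f x| * |g x| ≤ (C * Real.exp (c * ∑ i, |x i|)) * (D * Real.exp (d * ∑ i, |x i|)) :=
        mul_le_mul (hf x) (hg x) (abs_nonneg _) (by positivity)
    _ = _ := by ring

lemma PG.sub {f g : (Fin n → ℝ) → ℝ} (hf : PG f) (hg : PG g) : PG (fun x => f x - g x) := by
  have := hf.add ((PG.const (-1)).mul hg)
  convert this using 2
  ring

lemma PG.pow {f : (Fin n → ℝ) → ℝ} (hf : PG f) (k : ℕ) : PG (fun x => f x ^ k) := by
  induction k with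
  | zero => simpa using PG.const (n := n) 1
  | succ k ih => simpa [pow_succ] using ih.mul hf

lemma PG.sum {ι : Type*} (s : Finset ι) {f : ι → (Fin n → ℝ) → ℝ} (hf : ∀ i, PG (f i)) :
    PG (fun x => ∑ i ∈ s, f i x) := by
  classical
  induction s using Finset.induction_on with
  | empty => simpa using PG.const (n := n) 0
  | insert a s ha ih =>
    simp only [Finset.sum_insert ha]
    exact (hf a).add ih

lemma enorm_nonneg (x : Fin n → ℝ) : 0 ≤ enorm x := Real.sqrt_nonneg _

lemma enorm_le (x : Fin n → ℝ) : enorm x ≤ ∑ i, |x i| := by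
  unfold enorm
  rw [Real.sqrt_le_left (sum_abs_nonneg x)]
  have := Finset.sum_sq_le_sq_sum_of_nonneg (s := Finset.univ) (f := fun i => |x i|)
    (fun i _ => abs_nonneg _)
  simpa using this

lemma PG.of_poly {f : (Fin n → ℝ) → ℝ} (hf : Continuous f) (p : Polynomial ℝ)
    (h : ∀ x, |f x| ≤ p.eval (enorm x)) : PG f := by
  refine ⟨hf, ∑ k ∈ Finset.range (p.natDegree + 1), |p.coeff k|, p.natDegree,
    Finset.sum_nonneg fun _ _ => abs_nonneg _, Nat.cast_nonneg _, fun x => (h x).trans ?_⟩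
  rw [Polynomial.eval_eq_sum_range, Finset.sum_mul]
  refine Finset.sum_le_sum fun k hk => ?_
  have hk' : (k : ℝ) ≤ p.natDegree := by
    exact_mod_cast Nat.lt_succ_iff.1 (Finset.mem_range.1 hk)
  have he := enorm_nonneg x
  have h1 : enorm x ^ k ≤ Real.exp (p.natDegree * ∑ i, |x i|) := by
    have h2 : enorm x ≤ Real.exp (enorm x) := by linarith [Real.add_one_le_exp (enorm x)]
    calc enorm x ^ k ≤ Real.exp (enorm x) ^ k := pow_le_pow_left₀ he h2 k
      _ = Real.exp (k * enorm x) := by rw [Real.exp_nat_mul]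
      _ ≤ _ := Real.exp_le_exp.2 (mul_le_mul hk' (enorm_le x) he (Nat.cast_nonneg _))
  calc p.coeff k * enorm x ^ k ≤ |p.coeff k| * enorm x ^ k :=
        mul_le_mul_of_nonneg_right (le_abs_self _) (by positivity)
    _ ≤ _ := mul_le_mul_of_nonneg_left h1 (abs_nonneg _)

/-- The Gaussian weight. -/
def gw (x₀ : Fin n → ℝ) (t : ℝ) (x : Fin n → ℝ) : ℝ :=
  Real.exp (-(∑ i, (x i - x₀ i) ^ 2) / (4 * t))

lemma gw_contDiff (x₀ : Fin n → ℝ) (t : ℝ) : ContDiff ℝ (⊤ : ℕ∞) (gw x₀ t) := by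
  unfold gw
  fun_prop

lemma integrable_gauss (x₀ : Fin n → ℝ) {b : ℝ} (hb : 0 < b) :
    Integrable (fun x : Fin n → ℝ => Real.exp (∑ i, -b * (x i - x₀ i) ^ 2)) := by
  simp only [Real.exp_sum]
  exact Integrable.fintype_prod (f := fun i s => Real.exp (-b * (s - x₀ i) ^ 2))
    (μ := fun _ => volume)
    fun i => (integrable_exp_neg_mul_sq hb).comp_sub_right (x₀ i)

lemma PG.integrable {f : (Fin n → ℝ) → ℝ} (hf : PG f) (x₀ : Fin n → ℝ) {t : ℝ} (ht : 0 < t) :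
    Integrable (fun x => f x * gw x₀ t x) := by
  obtain ⟨hf0, C, c, hC, hc, hf⟩ := hf
  have hI := (integrable_gauss x₀ (b := 1 / (8 * t)) (by positivity)).const_mul
    (C * Real.exp (∑ i, (c * |x₀ i| + 2 * t * c ^ 2)))
  refine hI.mono' (hf0.mul (gw_contDiff x₀ t).continuous).aestronglyMeasurable
    (Eventually.of_forall fun x => ?_)
  have hg : 0 < gw x₀ t x := Real.exp_pos _
  rw [Real.norm_eq_abs, abs_mul, abs_of_pos hg, mul_assoc, ← Real.exp_add,
    ← Finset.sum_add_distrib]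
  refine (mul_le_mul_of_nonneg_right (hf x) hg.le).trans ?_
  rw [mul_assoc, gw, ← Real.exp_add]
  refine mul_le_mul_of_nonneg_left (Real.exp_le_exp.2 ?_) hC
  rw [Finset.mul_sum, neg_div, Finset.sum_div, ← sub_eq_add_neg, ← Finset.sum_sub_distrib]
  refine Finset.sum_le_sum fun i _ => ?_
  have h1 : |x i| ≤ |x₀ i| + |x i - x₀ i| := by
    have := abs_add_le (x₀ i) (x i - x₀ i)
    simpa using this
  have h2 : c * |x i| ≤ c * |x₀ i| + c * |x i - x₀ i| := by nlinarith
  have h3 : c * |x i - x₀ i| ≤ 2 * t * c ^ 2 + 1 / (8 * t) * (x i - x₀ i) ^ 2 := by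
    rw [← sq_abs (x i - x₀ i)]
    have h4 : 2 * t * c ^ 2 + 1 / (8 * t) * |x i - x₀ i| ^ 2 - c * |x i - x₀ i|
        = 1 / (8 * t) * (|x i - x₀ i| - 4 * t * c) ^ 2 := by
      field_simp; ring
    have : 0 ≤ 1 / (8 * t) * (|x i - x₀ i| - 4 * t * c) ^ 2 := by positivity
    linarith
  have h5 : (x i - x₀ i) ^ 2 / (4 * t) = 2 * (1 / (8 * t) * (x i - x₀ i) ^ 2) := by
    field_simp; ring
  rw [h5]
  linarith

lemma fderiv_gw (x₀ : Fin n → ℝ) (t : ℝ) (x : Fin n → ℝ) (i : Fin n) :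
    fderiv ℝ (gw x₀ t) x (Pi.single i 1) = -((x i - x₀ i) / (2 * t)) * gw x₀ t x := by
  have h0 : ∀ j : Fin n, HasFDerivAt (fun y : Fin n → ℝ => (y j - x₀ j) ^ 2)
      ((2 * (x j - x₀ j)) • (ContinuousLinearMap.proj j : (Fin n → ℝ) →L[ℝ] ℝ)) x := by
    intro j
    have h := (((ContinuousLinearMap.proj j : (Fin n → ℝ) →L[ℝ] ℝ).hasFDerivAt
      (x := x)).sub_const (x₀ j)).pow 2
    simpa using h
  have h1 : HasFDerivAt (gw x₀ t) _ x :=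
    ((HasFDerivAt.fun_sum (u := Finset.univ) fun j _ => h0 j).fun_neg.mul_const (4 * t)⁻¹).exp
  rw [h1.fderiv]
  have h2 : (∑ j, (2 * (x j - x₀ j)) * (Pi.single i (1:ℝ) : Fin n → ℝ) j) = 2 * (x i - x₀ i) := by
    simp [Pi.single_apply]
  simp only [_root_.smul_apply, _root_.neg_apply,
    _root_.sum_apply, ContinuousLinearMap.proj_apply, smul_eq_mul, h2]
  simp only [gw, div_eq_mul_inv]
  simp only [mul_inv]
  ring

lemma ibp_integrable {f : (Fin n → ℝ) → ℝ} (i : Fin n) (hpf : PG f)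
    (hpd : PG fun x => fderiv ℝ f x (Pi.single i 1)) (x₀ : Fin n → ℝ) {t : ℝ} (ht : 0 < t) :
    Integrable (fun x => (fderiv ℝ f x (Pi.single i 1) - (x i - x₀ i) / (2 * t) * f x)
      * gw x₀ t x) := by
  refine PG.integrable (hpd.sub (PG.mul ?_ hpf)) x₀ ht
  simp only [div_eq_mul_inv]
  exact ((PG.coord i).sub (PG.const _)).mul (PG.const _)

lemma ibp {f : (Fin n → ℝ) → ℝ} (hf : ContDiff ℝ (⊤ : ℕ∞) f) (i : Fin n) (hpf : PG f)
    (hpd : PG fun x => fderiv ℝ f x (Pi.single i 1)) (x₀ : Fin n → ℝ) {t : ℝ} (ht : 0 < t) :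
    ∫ x, (fderiv ℝ f x (Pi.single i 1) - (x i - x₀ i) / (2 * t) * f x) * gw x₀ t x = 0 := by
  have hX : PG (fun x : Fin n → ℝ => -((x i - x₀ i) / (2 * t))) := by
    have := (((PG.coord i).sub (PG.const (x₀ i))).mul (PG.const (2 * t)⁻¹)).mul (PG.const (-1))
    convert this using 2
    rw [div_eq_mul_inv]; ring
  have i1 := hpd.integrable x₀ ht
  have i2 : Integrable (fun x => f x * fderiv ℝ (gw x₀ t) x (Pi.single i 1)) := by
    simp only [fderiv_gw]
    have := (hpf.mul hX).integrable x₀ ht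
    simpa only [mul_assoc] using this
  have h := integral_mul_fderiv_eq_neg_fderiv_mul_of_integrable (μ := volume)
    (f := f) (g := gw x₀ t) (v := Pi.single i 1) i1 i2 (hpf.integrable x₀ ht)
    (fun x _ => (hf.differentiable (by simp)).differentiableAt)
    (fun x _ => ((gw_contDiff x₀ t).differentiable (by simp)).differentiableAt)
  have h2 := integral_add i1 i2
  rw [h, add_neg_cancel] at h2
  rw [← h2]
  congr 1
  funext x
  rw [fderiv_gw]
  ring

end YM

namespace YM

variable {n m : ℕ}

lemma frobSq_nonneg (A : Matrix (Fin m) (Fin m) ℝ) : 0 ≤ frobSq A :=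
  Finset.sum_nonneg fun _ _ => Finset.sum_nonneg fun _ _ => sq_nonneg _

lemma abs_entry_le (A : Matrix (Fin m) (Fin m) ℝ) (a b : Fin m) : |A a b| ≤ frobNorm A := by
  unfold frobNorm
  apply Real.abs_le_sqrt
  unfold frobSq
  calc A a b ^ 2 ≤ ∑ b, A a b ^ 2 :=
        Finset.single_le_sum (f := fun b => A a b ^ 2) (fun _ _ => sq_nonneg _) (Finset.mem_univ b)
    _ ≤ _ := Finset.single_le_sum (f := fun a => ∑ b, A a b ^ 2)
        (fun _ _ => Finset.sum_nonneg fun _ _ => sq_nonneg _) (Finset.mem_univ a)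

lemma frobNorm_curv_le (Γ : Conn n m) (i j : Fin n) (x : Fin n → ℝ) :
    frobNorm (curv Γ i j x) ≤ normF Γ x := by
  unfold frobNorm normF normSqF
  apply Real.sqrt_le_sqrt
  calc frobSq (curv Γ i j x) ≤ ∑ j, frobSq (curv Γ i j x) :=
        Finset.single_le_sum (f := fun j => frobSq (curv Γ i j x))
          (fun _ _ => frobSq_nonneg _) (Finset.mem_univ j)
    _ ≤ _ := Finset.single_le_sum (f := fun i => ∑ j, frobSq (curv Γ i j x))
        (fun _ _ => Finset.sum_nonneg fun _ _ => frobSq_nonneg _) (Finset.mem_univ i)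

lemma frobNorm_nonneg (A : Matrix (Fin m) (Fin m) ℝ) : 0 ≤ frobNorm A := Real.sqrt_nonneg _

lemma PG_curv {Γ : Conn n m} (hsm : Smooth Γ) (hp : PolyCurvGrowth2 Γ) (i j : Fin n)
    (a b : Fin m) : PG fun x => curv Γ i j x a b := by
  obtain ⟨p, hp⟩ := hp
  refine PG.of_poly ((hsm.curv i j) a b).continuous p fun x => le_trans ?_ (hp x)
  have h1 := (abs_entry_le (curv Γ i j x) a b).trans (frobNorm_curv_le Γ i j x)
  have h2 : 0 ≤ ∑ i, ∑ j, ∑ k, frobNorm (covDer Γ i (fun y => curv Γ j k y) x) :=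
    Finset.sum_nonneg fun _ _ => Finset.sum_nonneg fun _ _ => Finset.sum_nonneg fun _ _ =>
      frobNorm_nonneg _
  have h3 : 0 ≤ ∑ i, ∑ j, ∑ k, ∑ l, frobNorm (covDer Γ i
      (fun y => covDer Γ j (fun z => curv Γ k l z) y) x) :=
    Finset.sum_nonneg fun _ _ => Finset.sum_nonneg fun _ _ => Finset.sum_nonneg fun _ _ =>
      Finset.sum_nonneg fun _ _ => frobNorm_nonneg _
  linarith

lemma PG_covDer {Γ : Conn n m} (hsm : Smooth Γ) (hp : PolyCurvGrowth2 Γ) (k i j : Fin n)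
    (a b : Fin m) : PG fun x => covDer Γ k (fun y => curv Γ i j y) x a b := by
  obtain ⟨p, hp⟩ := hp
  refine PG.of_poly ((hsm.covDer k (hsm.curv i j)) a b).continuous p fun x => le_trans ?_ (hp x)
  have h1 := abs_entry_le (covDer Γ k (fun y => curv Γ i j y) x) a b
  have h2 : frobNorm (covDer Γ k (fun y => curv Γ i j y) x) ≤
      ∑ k, ∑ i, ∑ j, frobNorm (covDer Γ k (fun y => curv Γ i j y) x) := by
    calc frobNorm (covDer Γ k (fun y => curv Γ i j y) x)
        ≤ ∑ j, frobNorm (covDer Γ k (fun y => curv Γ i j y) x) :=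
          Finset.single_le_sum (f := fun j => frobNorm (covDer Γ k (fun y => curv Γ i j y) x))
            (fun _ _ => frobNorm_nonneg _) (Finset.mem_univ j)
      _ ≤ ∑ i, ∑ j, frobNorm (covDer Γ k (fun y => curv Γ i j y) x) :=
          Finset.single_le_sum
            (f := fun i => ∑ j, frobNorm (covDer Γ k (fun y => curv Γ i j y) x))
            (fun _ _ => Finset.sum_nonneg fun _ _ => frobNorm_nonneg _) (Finset.mem_univ i)
      _ ≤ _ := Finset.single_le_sum
            (f := fun k => ∑ i, ∑ j, frobNorm (covDer Γ k (fun y => curv Γ i j y) x))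
            (fun _ _ => Finset.sum_nonneg fun _ _ => Finset.sum_nonneg fun _ _ =>
              frobNorm_nonneg _) (Finset.mem_univ k)
  have h0 : 0 ≤ normF Γ x := Real.sqrt_nonneg _
  have h3 : 0 ≤ ∑ i, ∑ j, ∑ k, ∑ l, frobNorm (covDer Γ i
      (fun y => covDer Γ j (fun z => curv Γ k l z) y) x) :=
    Finset.sum_nonneg fun _ _ => Finset.sum_nonneg fun _ _ => Finset.sum_nonneg fun _ _ =>
      Finset.sum_nonneg fun _ _ => frobNorm_nonneg _
  linarith

lemma PG_frobInner {A B : (Fin n → ℝ) → Matrix (Fin m) (Fin m) ℝ}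
    (hA : ∀ a b, PG fun x => A x a b) (hB : ∀ a b, PG fun x => B x a b) :
    PG fun x => frobInner (A x) (B x) :=
  PG.sum _ fun a => PG.sum _ fun b => (hA a b).mul (hB a b)

/-- `T_{ij} = Σₖ ⟨F_{ik}, F_{jk}⟩`. -/
def TT (Γ : Conn n m) (i j : Fin n) (x : Fin n → ℝ) : ℝ :=
  ∑ k, frobInner (curv Γ i k x) (curv Γ j k x)

lemma normSqF_eq (Γ : Conn n m) (x : Fin n → ℝ) : normSqF Γ x = ∑ i, TT Γ i i x := by
  simp [normSqF, TT, frobSq_eq]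

lemma TT_contDiff {Γ : Conn n m} (hsm : Smooth Γ) (i j : Fin n) :
    ContDiff ℝ (⊤ : ℕ∞) (TT Γ i j) := by
  unfold TT
  exact ContDiff.sum fun k _ => (hsm.curv i k).frobInner (hsm.curv j k)

lemma fderiv_TT {Γ : Conn n m} (hsm : Smooth Γ) (hmc : MetricCompat Γ) (l i j : Fin n)
    (x : Fin n → ℝ) : fderiv ℝ (TT Γ i j) x (Pi.single l 1) =
      ∑ k, (frobInner (covDer Γ l (fun y => curv Γ i k y) x) (curv Γ j k x)
        + frobInner (curv Γ i k x) (covDer Γ l (fun y => curv Γ j k y) x)) := by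
  unfold TT
  rw [fderiv_fun_sum (fun k _ => (((hsm.curv i k).frobInner (hsm.curv j k)).differentiable
    (by simp)).differentiableAt), _root_.sum_apply]
  exact Finset.sum_congr rfl fun k _ => fderiv_frobInner hmc l (hsm.curv i k) (hsm.curv j k) x

lemma PG_TT {Γ : Conn n m} (hsm : Smooth Γ) (hp : PolyCurvGrowth2 Γ) (i j : Fin n) :
    PG (TT Γ i j) :=
  PG.sum _ fun k => PG_frobInner (PG_curv hsm hp i k) (PG_curv hsm hp j k)

lemma PG_fderiv_TT {Γ : Conn n m} (hsm : Smooth Γ) (hmc : MetricCompat Γ)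
    (hp : PolyCurvGrowth2 Γ) (l i j : Fin n) :
    PG fun x => fderiv ℝ (TT Γ i j) x (Pi.single l 1) := by
  simp only [fderiv_TT hsm hmc]
  exact PG.sum _ fun k => (PG_frobInner (PG_covDer hsm hp l i k) (PG_curv hsm hp j k)).add
    (PG_frobInner (PG_curv hsm hp i k) (PG_covDer hsm hp l j k))

lemma normSqF_contDiff {Γ : Conn n m} (hsm : Smooth Γ) :
    ContDiff ℝ (⊤ : ℕ∞) (normSqF Γ) := by
  have : normSqF Γ = fun x => ∑ i, TT Γ i i x := funext (normSqF_eq Γ)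
  rw [this]
  exact ContDiff.sum fun i _ => TT_contDiff hsm i i

lemma fderiv_normSqF {Γ : Conn n m} (hsm : Smooth Γ) (l : Fin n) (x : Fin n → ℝ) :
    fderiv ℝ (normSqF Γ) x (Pi.single l 1) = ∑ i, fderiv ℝ (TT Γ i i) x (Pi.single l 1) := by
  have : normSqF Γ = fun x => ∑ i, TT Γ i i x := funext (normSqF_eq Γ)
  rw [this, fderiv_fun_sum (fun i _ => ((TT_contDiff hsm i i).differentiable
    (by simp)).differentiableAt), _root_.sum_apply]

lemma PG_normSqF {Γ : Conn n m} (hsm : Smooth Γ) (hp : PolyCurvGrowth2 Γ) : PG (normSqF Γ) := by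
  have : normSqF Γ = fun x => ∑ i, TT Γ i i x := funext (normSqF_eq Γ)
  rw [this]
  exact PG.sum _ fun i => PG_TT hsm hp i i

lemma PG_fderiv_normSqF {Γ : Conn n m} (hsm : Smooth Γ) (hmc : MetricCompat Γ)
    (hp : PolyCurvGrowth2 Γ) (l : Fin n) :
    PG fun x => fderiv ℝ (normSqF Γ) x (Pi.single l 1) := by
  simp only [fderiv_normSqF hsm]
  exact PG.sum _ fun i => PG_fderiv_TT hsm hmc hp l i i

lemma bianchi_contract {Γ : Conn n m} (hsm : Smooth Γ) (j : Fin n) (x : Fin n → ℝ) :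
    2 * ∑ i, ∑ k, frobInner (curv Γ i k x) (covDer Γ i (fun y => curv Γ j k y) x)
      = ∑ i, ∑ k, frobInner (curv Γ i k x) (covDer Γ j (fun y => curv Γ i k y) x) := by
  have h : ∑ i, ∑ k, frobInner (curv Γ i k x) (covDer Γ i (fun y => curv Γ j k y) x)
      = ∑ i, ∑ k, frobInner (curv Γ k i x) (covDer Γ k (fun y => curv Γ j i y) x) :=
    Finset.sum_comm
  rw [two_mul]
  nth_rewrite 2 [h]
  simp only [← Finset.sum_add_distrib]
  refine Finset.sum_congr rfl fun i _ => Finset.sum_congr rfl fun k _ => ?_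
  have hb := bianchi hsm i j k x
  have hb' : covDer Γ j (fun y => curv Γ i k y) x =
      covDer Γ i (fun y => curv Γ j k y) x + covDer Γ k (fun y => curv Γ i j y) x := by
    rw [covDer_curv_antisymm j i k, ← sub_eq_zero, ← neg_eq_zero, ← hb]
    abel
  rw [hb', frobInner_add_right, curv_antisymm Γ k i, covDer_curv_antisymm k j i,
    frobInner_neg_left, frobInner_neg_right, neg_neg]

lemma div_TT {Γ : Conn n m} (hsm : Smooth Γ) (hmc : MetricCompat Γ) {x₀ : Fin n → ℝ} {t : ℝ}
    (hsol : IsSolitonAt Γ x₀ t) (j : Fin n) (x : Fin n → ℝ) :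
    ∑ i, fderiv ℝ (TT Γ i j) x (Pi.single i 1) =
      (1 / (2 * t)) * ∑ i, (x i - x₀ i) * TT Γ i j x
        + 1 / 4 * fderiv ℝ (normSqF Γ) x (Pi.single j 1) := by
  have h1 : fderiv ℝ (normSqF Γ) x (Pi.single j 1) =
      2 * ∑ i, ∑ k, frobInner (curv Γ i k x) (covDer Γ j (fun y => curv Γ i k y) x) := by
    rw [fderiv_normSqF hsm, Finset.mul_sum]
    refine Finset.sum_congr rfl fun i _ => ?_
    rw [fderiv_TT hsm hmc, Finset.mul_sum]
    refine Finset.sum_congr rfl fun k _ => ?_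
    rw [frobInner_symm]
    ring
  have h2 : ∑ i, ∑ k, frobInner (covDer Γ i (fun y => curv Γ i k y) x) (curv Γ j k x)
      = (1 / (2 * t)) * ∑ i, (x i - x₀ i) * TT Γ i j x := by
    rw [Finset.sum_comm]
    simp only [← frobInner_sum_left, hsol x]
    simp only [frobInner_smul_left, frobInner_sum_left, TT, Finset.mul_sum]
    rw [Finset.sum_comm]
  have h3 := bianchi_contract hsm j x
  simp only [fderiv_TT hsm hmc, Finset.sum_add_distrib]
  rw [h2, h1]
  linarith

lemma integral_lin (f g h k : (Fin n → ℝ) → ℝ) (hf : Integrable f) (hg : Integrable g)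
    (hh : Integrable h) (hk : Integrable k) :
    ∫ x, (f x - g x + h x - k x) = (∫ x, f x) - (∫ x, g x) + (∫ x, h x) - ∫ x, k x := by
  have h1 : Integrable (fun x => f x - g x) := hf.sub hg
  have h2 : Integrable (fun x => f x - g x + h x) := h1.add hh
  rw [integral_sub h2 hk, integral_add h1 hh, integral_sub hf hg]

/-- The weighted Pohozaev-type identity for a soliton. -/
lemma main_identity {Γ : Conn n m} (hsm : Smooth Γ) (hmc : MetricCompat Γ)
    (hp : PolyCurvGrowth2 Γ) {x₀ : Fin n → ℝ} {t : ℝ} (ht : 0 < t)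
    (hsol : IsSolitonAt Γ x₀ t) (W : Fin n → (Fin n → ℝ) → ℝ)
    (DW : Fin n → Fin n → (Fin n → ℝ) → ℝ) (hW : ∀ j, ContDiff ℝ (⊤ : ℕ∞) (W j))
    (hDW : ∀ i j x, fderiv ℝ (W j) x (Pi.single i 1) = DW i j x)
    (hpW : ∀ j, PG (W j)) (hpD : ∀ i j, PG (DW i j)) :
    ∫ x, (∑ j, (x j - x₀ j) * W j x) * normSqF Γ x * gw x₀ t x
      = 2 * t * (∫ x, (∑ j, DW j j x) * normSqF Γ x * gw x₀ t x)
        - 8 * t * (∫ x, (∑ i, ∑ j, DW i j x * TT Γ i j x) * gw x₀ t x) := by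
  have hprod : ∀ (f : (Fin n → ℝ) → ℝ) (_ : ContDiff ℝ (⊤ : ℕ∞) f) (i j : Fin n) (x : Fin n → ℝ),
      fderiv ℝ (fun y => W j y * f y) x (Pi.single i 1) =
        DW i j x * f x + W j x * fderiv ℝ f x (Pi.single i 1) := by
    intro f hf i j x
    rw [fderiv_fun_mul ((hW j).differentiable (by simp)).differentiableAt
      (hf.differentiable (by simp)).differentiableAt]
    simp only [_root_.add_apply, _root_.smul_apply, smul_eq_mul, hDW]
    ring
  have hT0 : ∀ i j, PG fun x => W j x * TT Γ i j x := fun i j => (hpW j).mul (PG_TT hsm hp i j)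
  have hT1 : ∀ i j, PG fun x => fderiv ℝ (fun y => W j y * TT Γ i j y) x (Pi.single i 1) := by
    intro i j
    simp only [hprod _ (TT_contDiff hsm i j)]
    exact ((hpD i j).mul (PG_TT hsm hp i j)).add ((hpW j).mul (PG_fderiv_TT hsm hmc hp i i j))
  have hE0 : ∀ j, PG fun x => W j x * normSqF Γ x := fun j => (hpW j).mul (PG_normSqF hsm hp)
  have hE1 : ∀ j, PG fun x => fderiv ℝ (fun y => W j y * normSqF Γ y) x (Pi.single j 1) := by
    intro j
    simp only [hprod _ (normSqF_contDiff hsm)]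
    exact ((hpD j j).mul (PG_normSqF hsm hp)).add ((hpW j).mul (PG_fderiv_normSqF hsm hmc hp j))
  have zT : ∫ x, ∑ i, ∑ j, (fderiv ℝ (fun y => W j y * TT Γ i j y) x (Pi.single i 1)
      - (x i - x₀ i) / (2 * t) * (W j x * TT Γ i j x)) * gw x₀ t x = 0 := by
    rw [integral_finsetSum _ fun i _ => integrable_finsetSum _ fun j _ =>
      ibp_integrable i (hT0 i j) (hT1 i j) x₀ ht]
    refine Finset.sum_eq_zero fun i _ => ?_
    rw [integral_finsetSum _ fun j _ => ibp_integrable i (hT0 i j) (hT1 i j) x₀ ht]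
    exact Finset.sum_eq_zero fun j _ =>
      ibp ((hW j).mul (TT_contDiff hsm i j)) i (hT0 i j) (hT1 i j) x₀ ht
  have zE : ∫ x, ∑ j, (fderiv ℝ (fun y => W j y * normSqF Γ y) x (Pi.single j 1)
      - (x j - x₀ j) / (2 * t) * (W j x * normSqF Γ x)) * gw x₀ t x = 0 := by
    rw [integral_finsetSum _ fun j _ => ibp_integrable j (hE0 j) (hE1 j) x₀ ht]
    exact Finset.sum_eq_zero fun j _ =>
      ibp ((hW j).mul (normSqF_contDiff hsm)) j (hE0 j) (hE1 j) x₀ ht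
  have iT : Integrable fun x => ∑ i, ∑ j,
      (fderiv ℝ (fun y => W j y * TT Γ i j y) x (Pi.single i 1)
      - (x i - x₀ i) / (2 * t) * (W j x * TT Γ i j x)) * gw x₀ t x :=
    integrable_finsetSum _ fun i _ => integrable_finsetSum _ fun j _ =>
      ibp_integrable i (hT0 i j) (hT1 i j) x₀ ht
  have iE : Integrable fun x => ∑ j,
      (fderiv ℝ (fun y => W j y * normSqF Γ y) x (Pi.single j 1)
      - (x j - x₀ j) / (2 * t) * (W j x * normSqF Γ x)) * gw x₀ t x :=
    integrable_finsetSum _ fun j _ => ibp_integrable j (hE0 j) (hE1 j) x₀ ht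
  have i1 : Integrable fun x => (∑ j, DW j j x) * normSqF Γ x * gw x₀ t x :=
    ((PG.sum _ fun j => hpD j j).mul (PG_normSqF hsm hp)).integrable x₀ ht
  have i2 : Integrable fun x => (∑ i, ∑ j, DW i j x * TT Γ i j x) * gw x₀ t x :=
    (PG.sum _ fun i => PG.sum _ fun j => (hpD i j).mul (PG_TT hsm hp i j)).integrable x₀ ht
  have hpt : ∀ x, (∑ j, (x j - x₀ j) * W j x) * normSqF Γ x * gw x₀ t x =
      ((2 * t * ((∑ j, DW j j x) * normSqF Γ x * gw x₀ t x)
        - 8 * t * ((∑ i, ∑ j, DW i j x * TT Γ i j x) * gw x₀ t x))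
      + 8 * t * (∑ i, ∑ j, (fderiv ℝ (fun y => W j y * TT Γ i j y) x (Pi.single i 1)
      - (x i - x₀ i) / (2 * t) * (W j x * TT Γ i j x)) * gw x₀ t x))
      - 2 * t * (∑ j, (fderiv ℝ (fun y => W j y * normSqF Γ y) x (Pi.single j 1)
      - (x j - x₀ j) / (2 * t) * (W j x * normSqF Γ x)) * gw x₀ t x) := by
    intro x
    have e1 : ∑ i, ∑ j, (fderiv ℝ (fun y => W j y * TT Γ i j y) x (Pi.single i 1)
        - (x i - x₀ i) / (2 * t) * (W j x * TT Γ i j x)) * gw x₀ t x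
        = ((∑ i, ∑ j, DW i j x * TT Γ i j x)
          + 1 / 4 * ∑ j, W j x * fderiv ℝ (normSqF Γ) x (Pi.single j 1)) * gw x₀ t x := by
      simp only [← Finset.sum_mul]
      congr 1
      simp only [hprod _ (TT_contDiff hsm _ _), add_sub_assoc, Finset.sum_add_distrib]
      congr 1
      rw [Finset.sum_comm, Finset.mul_sum]
      refine Finset.sum_congr rfl fun j _ => ?_
      have hd := div_TT hsm hmc hsol j x
      rw [Finset.sum_sub_distrib, ← Finset.mul_sum, hd, mul_add, Finset.mul_sum, Finset.mul_sum]
      have : ∑ i, W j x * (1 / (2 * t) * ((x i - x₀ i) * TT Γ i j x))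
          = ∑ i, (x i - x₀ i) / (2 * t) * (W j x * TT Γ i j x) :=
        Finset.sum_congr rfl fun i _ => by ring
      rw [this]
      ring
    have e2 : ∑ j, (fderiv ℝ (fun y => W j y * normSqF Γ y) x (Pi.single j 1)
        - (x j - x₀ j) / (2 * t) * (W j x * normSqF Γ x)) * gw x₀ t x
        = ((∑ j, DW j j x) * normSqF Γ x
          + (∑ j, W j x * fderiv ℝ (normSqF Γ) x (Pi.single j 1))
          - 1 / (2 * t) * ((∑ j, (x j - x₀ j) * W j x) * normSqF Γ x)) * gw x₀ t x := by
      simp only [← Finset.sum_mul]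
      congr 1
      simp only [hprod _ (normSqF_contDiff hsm), Finset.sum_sub_distrib, Finset.sum_add_distrib,
        Finset.sum_mul, Finset.mul_sum]
      congr 1
      exact Finset.sum_congr rfl fun j _ => by ring
    rw [e1, e2]
    field_simp
    ring
  rw [integral_congr_ae (Eventually.of_forall hpt)]
  rw [integral_lin _ _ _ _ (i1.const_mul _) (i2.const_mul _) (iT.const_mul _) (iE.const_mul _)]
  simp only [integral_const_mul]
  rw [zT, zE]
  ring

/-- `|V ⌟ F|² = Σ_{ij} VᵢVⱼ T_{ij}`. -/
lemma contract_sq (Γ : Conn n m) (v : Fin n → ℝ) (x : Fin n → ℝ) :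
    ∑ k, frobSq (∑ i, v i • curv Γ i k x) = ∑ i, ∑ j, v i * v j * TT Γ i j x := by
  simp only [frobSq_eq, frobInner_sum_left, frobInner_sum_right, frobInner_smul_left,
    frobInner_smul_right, TT, Finset.mul_sum]
  rw [Finset.sum_comm]
  refine Finset.sum_congr rfl fun i _ => ?_
  rw [Finset.sum_comm]
  exact Finset.sum_congr rfl fun j _ => Finset.sum_congr rfl fun k _ => by
    rw [frobInner_symm (curv Γ j k x)]; ring

lemma frobSq_smul (c : ℝ) (A : Matrix (Fin m) (Fin m) ℝ) : frobSq (c • A) = c ^ 2 * frobSq A := by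
  rw [frobSq_eq, frobSq_eq, frobInner_smul_left, frobInner_smul_right]; ring

lemma dstar_sq {Γ : Conn n m} {x₀ : Fin n → ℝ} {t : ℝ}
    (hsol : IsSolitonAt Γ x₀ t) (x : Fin n → ℝ) :
    ∑ k, frobSq (dstarF Γ k x) = (1 / (2 * t)) ^ 2 *
      ∑ i, ∑ j, (x i - x₀ i) * (x j - x₀ j) * TT Γ i j x := by
  rw [← contract_sq Γ (fun i => x i - x₀ i) x, Finset.mul_sum]
  refine Finset.sum_congr rfl fun k _ => ?_
  rw [dstarF, hsol x k, ← frobSq_smul, frobSq_eq, frobSq_eq, frobInner_neg_left,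
    frobInner_neg_right, neg_neg]

lemma fderiv_X (x₀ : Fin n → ℝ) (x : Fin n → ℝ) (i j : Fin n) :
    fderiv ℝ (fun y : Fin n → ℝ => y j - x₀ j) x (Pi.single i 1) = if i = j then 1 else 0 := by
  have h := ((ContinuousLinearMap.proj j : (Fin n → ℝ) →L[ℝ] ℝ).hasFDerivAt
      (x := x)).sub_const (x₀ j)
  have h' : HasFDerivAt (fun y : Fin n → ℝ => y j - x₀ j)
    (ContinuousLinearMap.proj j : (Fin n → ℝ) →L[ℝ] ℝ) x := h
  rw [h'.fderiv]
  simp [Pi.single_apply, eq_comm]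

lemma fderiv_VX (V x₀ : Fin n → ℝ) (x : Fin n → ℝ) (i : Fin n) :
    fderiv ℝ (fun y : Fin n → ℝ => ∑ j, V j * (y j - x₀ j)) x (Pi.single i 1) = V i := by
  rw [fderiv_fun_sum (fun j _ => by fun_prop), _root_.sum_apply]
  have : ∀ j, fderiv ℝ (fun y : Fin n → ℝ => V j * (y j - x₀ j)) x (Pi.single i 1)
      = V j * if i = j then 1 else 0 := by
    intro j
    rw [fderiv_const_mul (by fun_prop), _root_.smul_apply, fderiv_X, smul_eq_mul]
  simp [this]

lemma fderiv_r2 (x₀ : Fin n → ℝ) (x : Fin n → ℝ) (i : Fin n) :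
    fderiv ℝ (fun y : Fin n → ℝ => ∑ j, (y j - x₀ j) ^ 2) x (Pi.single i 1)
      = 2 * (x i - x₀ i) := by
  rw [fderiv_fun_sum (fun j _ => by fun_prop), _root_.sum_apply]
  have : ∀ j, fderiv ℝ (fun y : Fin n → ℝ => (y j - x₀ j) ^ 2) x (Pi.single i 1)
      = 2 * (x j - x₀ j) * if i = j then 1 else 0 := by
    intro j
    rw [fderiv_fun_pow 2 (by fun_prop), _root_.smul_apply, fderiv_X, smul_eq_mul]
    simp
  simp [this]

lemma PG_X (x₀ : Fin n → ℝ) (i : Fin n) : PG fun x : Fin n → ℝ => x i - x₀ i :=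
  (PG.coord i).sub (PG.const _)

end YM
/-- **Soliton integral identities (c), (e)** (Corollary `5partlemma`). -/
theorem soliton_identities_ce (n m : ℕ) (Γ : YM.Conn n m)
    (hsm : YM.Smooth Γ) (hmc : YM.MetricCompat Γ)
    (x₀ : Fin n → ℝ) (t₀ : ℝ) (ht₀ : 0 < t₀)
    (hsol : YM.IsSolitonAt Γ x₀ t₀) (hpoly : YM.PolyCurvGrowth2 Γ)
    (V : Fin n → ℝ)
    (G₀ : (Fin n → ℝ) → ℝ)
    (hG₀ : G₀ = fun x => Real.exp (-(∑ i, (x i - x₀ i) ^ 2) / (4 * t₀))) :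
    ((∫ x : Fin n → ℝ,
        (∑ i, (x i - x₀ i) ^ 2) ^ 2 * YM.normSqF Γ x * G₀ x)
      = 4 * ((n : ℝ) - 2) * ((n : ℝ) - 4) * t₀ ^ 2 *
          (∫ x : Fin n → ℝ, YM.normSqF Γ x * G₀ x)
        - 64 * t₀ ^ 3 *
          (∫ x : Fin n → ℝ, (∑ k, YM.frobSq (YM.dstarF Γ k x)) * G₀ x)) ∧
    ((∫ x : Fin n → ℝ,
        (∑ i, V i * (x i - x₀ i)) ^ 2 * YM.normSqF Γ x * G₀ x)
      = 2 * t₀ * (∑ i, V i ^ 2) *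
          (∫ x : Fin n → ℝ, YM.normSqF Γ x * G₀ x)
        - 8 * t₀ *
          (∫ x : Fin n → ℝ,
            (∑ k, YM.frobSq (∑ i, V i • YM.curv Γ i k x)) * G₀ x)) := by
  classical
  have hGw : G₀ = YM.gw x₀ t₀ := hG₀
  rw [hGw]
  clear hGw hG₀
  constructor
  · have h1 := YM.main_identity hsm hmc hpoly ht₀ hsol (fun j x => x j - x₀ j)
      (fun i j _ => if i = j then 1 else 0) (fun j => by fun_prop)
      (fun i j x => YM.fderiv_X x₀ x i j) (YM.PG_X x₀) (fun i j => YM.PG.const _)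
    have hr : YM.PG fun x : Fin n → ℝ => ∑ i, (x i - x₀ i) ^ 2 :=
      YM.PG.sum _ fun i => (YM.PG_X x₀ i).pow 2
    have h2 := YM.main_identity hsm hmc hpoly ht₀ hsol
      (fun j x => (∑ i, (x i - x₀ i) ^ 2) * (x j - x₀ j))
      (fun i j x => (∑ i, (x i - x₀ i) ^ 2) * (if i = j then 1 else 0)
        + 2 * ((x i - x₀ i) * (x j - x₀ j))) (fun j => by fun_prop)
      (fun i j x => by
        rw [fderiv_fun_mul (by fun_prop) (by fun_prop), _root_.add_apply, _root_.smul_apply,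
          _root_.smul_apply, YM.fderiv_X, YM.fderiv_r2, smul_eq_mul, smul_eq_mul]
        ring)
      (fun j => hr.mul (YM.PG_X x₀ j))
      (fun i j => (hr.mul (YM.PG.const _)).add
        ((YM.PG.const 2).mul ((YM.PG_X x₀ i).mul (YM.PG_X x₀ j))))
    have iE : Integrable fun x => YM.normSqF Γ x * YM.gw x₀ t₀ x :=
      (YM.PG_normSqF hsm hpoly).integrable x₀ ht₀
    have iR : Integrable fun x => (∑ i, (x i - x₀ i) ^ 2) * YM.normSqF Γ x * YM.gw x₀ t₀ x :=
      (hr.mul (YM.PG_normSqF hsm hpoly)).integrable x₀ ht₀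
    have iD : Integrable fun x => (∑ i, ∑ j, (x i - x₀ i) * (x j - x₀ j) * YM.TT Γ i j x)
        * YM.gw x₀ t₀ x :=
      (YM.PG.sum _ fun i => YM.PG.sum _ fun j => ((YM.PG_X x₀ i).mul (YM.PG_X x₀ j)).mul
        (YM.PG_TT hsm hpoly i j)).integrable x₀ ht₀
    have a1 : ∀ x : Fin n → ℝ, ∑ j, (x j - x₀ j) * (x j - x₀ j) = ∑ i, (x i - x₀ i) ^ 2 :=
      fun x => Finset.sum_congr rfl fun j _ => by ring
    have a2 : ∀ x : Fin n → ℝ, ∑ i, ∑ j, (if i = j then (1 : ℝ) else 0) * YM.TT Γ i j x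
        = YM.normSqF Γ x := fun x => by
      rw [YM.normSqF_eq]
      simp
    simp only [a1, a2, if_true, Finset.sum_const, Finset.card_univ, Fintype.card_fin,
      nsmul_eq_mul, mul_one, mul_assoc, integral_const_mul] at h1
    have b1 : ∀ x : Fin n → ℝ, ∑ j, (x j - x₀ j) * ((∑ i, (x i - x₀ i) ^ 2) * (x j - x₀ j))
        = (∑ i, (x i - x₀ i) ^ 2) ^ 2 := fun x => by
      rw [sq (∑ i, (x i - x₀ i) ^ 2)]
      nth_rewrite 3 [← a1]
      rw [Finset.mul_sum]
      exact Finset.sum_congr rfl fun j _ => by ring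
    have b2 : ∀ x : Fin n → ℝ, (∑ j, ((∑ i, (x i - x₀ i) ^ 2)
        + 2 * ((x j - x₀ j) * (x j - x₀ j)))) * YM.normSqF Γ x * YM.gw x₀ t₀ x
        = ((n : ℝ) + 2) * ((∑ i, (x i - x₀ i) ^ 2) * YM.normSqF Γ x * YM.gw x₀ t₀ x) := fun x => by
      rw [Finset.sum_add_distrib, ← Finset.mul_sum, a1]
      simp
      ring
    have b3 : ∀ x : Fin n → ℝ, (∑ i, ∑ j, ((∑ i, (x i - x₀ i) ^ 2) * (if i = j then (1 : ℝ) else 0)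
        + 2 * ((x i - x₀ i) * (x j - x₀ j))) * YM.TT Γ i j x) * YM.gw x₀ t₀ x
        = (∑ i, (x i - x₀ i) ^ 2) * YM.normSqF Γ x * YM.gw x₀ t₀ x +
          2 * ((∑ i, ∑ j, (x i - x₀ i) * (x j - x₀ j) * YM.TT Γ i j x) * YM.gw x₀ t₀ x) :=
      fun x => by
      simp only [add_mul, Finset.sum_add_distrib, mul_assoc, ← Finset.mul_sum]
      simp only [← mul_assoc, a2]
    simp only [b1, if_true, mul_one, b2, b3] at h2
    rw [integral_add iR (iD.const_mul _), integral_const_mul, integral_const_mul] at h2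
    have c1 : ∫ x : Fin n → ℝ, (∑ k, YM.frobSq (YM.dstarF Γ k x)) * YM.gw x₀ t₀ x
        = (1 / (2 * t₀)) ^ 2 * ∫ x : Fin n → ℝ,
          (∑ i, ∑ j, (x i - x₀ i) * (x j - x₀ j) * YM.TT Γ i j x) * YM.gw x₀ t₀ x := by
      rw [← integral_const_mul]
      simp only [YM.dstar_sq hsol, mul_assoc]
    rw [c1, h2]
    have h1' : ∫ x : Fin n → ℝ, (∑ i, (x i - x₀ i) ^ 2) * YM.normSqF Γ x * YM.gw x₀ t₀ x
        = 2 * t₀ * ((n : ℝ) - 4) * ∫ x : Fin n → ℝ, YM.normSqF Γ x * YM.gw x₀ t₀ x := by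
      simp only [mul_assoc]
      rw [h1]
      ring
    rw [h1']
    field_simp
    ring
  · have hv : YM.PG fun x : Fin n → ℝ => ∑ i, V i * (x i - x₀ i) :=
      YM.PG.sum _ fun i => (YM.PG.const _).mul (YM.PG_X x₀ i)
    have h := YM.main_identity hsm hmc hpoly ht₀ hsol
      (fun j x => (∑ i, V i * (x i - x₀ i)) * V j) (fun i j _ => V i * V j)
      (fun j => by fun_prop)
      (fun i j x => by
        rw [fderiv_mul_const (by fun_prop), _root_.smul_apply, YM.fderiv_VX, smul_eq_mul]
        ring)
      (fun j => hv.mul (YM.PG.const _)) (fun i j => YM.PG.const _)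
    have b1 : ∀ x : Fin n → ℝ, ∑ j, (x j - x₀ j) * ((∑ i, V i * (x i - x₀ i)) * V j)
        = (∑ i, V i * (x i - x₀ i)) ^ 2 := fun x => by
      rw [sq, Finset.mul_sum Finset.univ (fun i => V i * (x i - x₀ i))]
      exact Finset.sum_congr rfl fun j _ => by ring
    have b2 : ∑ j, V j * V j = ∑ i, V i ^ 2 := Finset.sum_congr rfl fun j _ => by ring
    simp only [b1, b2, ← YM.contract_sq] at h
    rw [h]
    simp only [mul_assoc, integral_const_mul]
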